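/- arXiv:math/0502418 — 6 statements merged into one kernel-verified Lean document; each statement's English description precedes it below -/
import Mathlib

section
/- Let K be a field of characteristic 0 and n ≥ 1. Let p₁,…,p_r ∈ Kⁿ be points and let m'₁,…,m'_r and m₁,…,m_r be nonnegative integers such that for every j: if m'_j > 0 then m_j < m'_j, and if m'_j = 0 then m_j = 0; assume m'_j > 0 for at least one j. Then the fat point ideal ⋂_{j=1}^r P(p_j)^{m'_j} is contained in the product ideal 𝔪 · (⋂_{j=1}^r P(p_j)^{m_j}). -/
open MvPolynomial

/-- The ideal of a point `p ∈ Kⁿ`: generated by the homogeneous linear forms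
vanishing at `p`. -/
noncomputable def pointIdeal {K : Type} [Field K] {n : ℕ} (p : Fin n → K) :
    Ideal (MvPolynomial (Fin n) K) :=
  Ideal.span {ℓ : MvPolynomial (Fin n) K | ℓ.IsHomogeneous 1 ∧ eval p ℓ = 0}

/-- The irrelevant ideal `𝔪 = (x₁,…,x_n)`. -/
noncomputable def irrIdeal (K : Type) [Field K] (n : ℕ) :
    Ideal (MvPolynomial (Fin n) K) :=
  Ideal.span (Set.range X)

/-- A derivation lowers the order of vanishing along an ideal by at most one. -/
theorem Derivation.apply_mem_pow_of_mem_pow_succ {R A : Type*} [CommSemiring R] [CommSemiring A]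
    [Algebra R A] (D : Derivation R A A) (I : Ideal A) (k : ℕ) {x : A} (hx : x ∈ I ^ (k + 1)) :
    D x ∈ I ^ k := by
  induction k generalizing x with
  | zero => simp
  | succ k ih =>
    rw [pow_succ] at hx
    refine Submodule.mul_induction_on hx (fun a ha b hb => ?_) (fun a b ha hb => ?_)
    · rw [D.leibniz, smul_eq_mul, smul_eq_mul]
      refine add_mem (Ideal.mul_mem_right _ _ ha) ?_
      rw [pow_succ']
      exact Ideal.mul_mem_mul hb (ih ha)
    · rw [map_add]
      exact add_mem ha hb

section Homogeneity

attribute [local instance] MvPolynomial.gradedAlgebra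

theorem Ideal.IsHomogeneous.homogeneousComponent_mem {R σ : Type*} [CommSemiring R]
    {I : Ideal (MvPolynomial σ R)} (hI : I.IsHomogeneous (homogeneousSubmodule σ R))
    {f : MvPolynomial σ R} (hf : f ∈ I) (d : ℕ) : homogeneousComponent d f ∈ I := by
  rw [← decomposition.decompose'_apply]
  exact hI d hf

theorem isHomogeneous_pointIdeal_pow {K : Type} [Field K] {n : ℕ} (p : Fin n → K) (k : ℕ) :
    (pointIdeal p ^ k).IsHomogeneous (homogeneousSubmodule (Fin n) K) := by
  have h : (pointIdeal p).IsHomogeneous (homogeneousSubmodule (Fin n) K) :=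
    Ideal.homogeneous_span _ _ fun l hl => ⟨1, hl.1⟩
  induction k with
  | zero =>
    rw [pow_zero, Ideal.one_eq_top]
    exact Ideal.IsHomogeneous.top _
  | succ k ih =>
    rw [pow_succ]
    exact ih.mul h

theorem homogeneousComponent_mem_iInf_pointIdeal_pow {K : Type} [Field K] {n : ℕ} {ι : Sort*}
    (p : ι → Fin n → K) (m : ι → ℕ) {f : MvPolynomial (Fin n) K}
    (hf : f ∈ ⨅ j, pointIdeal (p j) ^ m j) (d : ℕ) :
    homogeneousComponent d f ∈ ⨅ j, pointIdeal (p j) ^ m j :=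
  (Ideal.IsHomogeneous.iInf fun j =>
    isHomogeneous_pointIdeal_pow (p j) (m j)).homogeneousComponent_mem hf d

end Homogeneity

theorem constantCoeff_eq_zero_of_mem_pointIdeal {K : Type} [Field K] {n : ℕ} {p : Fin n → K}
    {f : MvPolynomial (Fin n) K} (hf : f ∈ pointIdeal p) : constantCoeff f = 0 := by
  have h : pointIdeal p ≤ RingHom.ker (constantCoeff (σ := Fin n) (R := K)) :=
    Ideal.span_le.2 fun l hl => hl.1.coeff_eq_zero (by simp)
  exact h hf

/-- If all partial derivatives of a form of positive degree lie in `J`, the form lies in `𝔪 * J`,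
by Euler's identity. -/
theorem mem_irrIdeal_mul_of_pderiv_mem {K : Type} [Field K] [CharZero K] {n d : ℕ} (hd : d ≠ 0)
    {f : MvPolynomial (Fin n) K} (hf : f.IsHomogeneous d) {J : Ideal (MvPolynomial (Fin n) K)}
    (hJ : ∀ i, pderiv i f ∈ J) : f ∈ irrIdeal K n * J := by
  have hsum : d • f ∈ irrIdeal K n * J := by
    rw [← hf.sum_X_mul_pderiv]
    exact sum_mem fun i _ => Ideal.mul_mem_mul (Ideal.subset_span ⟨i, rfl⟩) (hJ i)
  have hscale : C ((d : K)⁻¹) * d • f = f := by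
    rw [nsmul_eq_mul, ← mul_assoc, ← map_natCast (C (σ := Fin n) (R := K)) d, ← C_mul,
      inv_mul_cancel₀ (Nat.cast_ne_zero.2 hd), C_1, one_mul]
  rw [← hscale]
  exact Ideal.mul_mem_left _ _ hsum

/-- In characteristic 0, if `m'_j > m_j` whenever `m'_j > 0` (and `m_j = 0` when
`m'_j = 0`, with `m'_j > 0` for some `j`), then
`⋂ⱼ P(pⱼ)^{m'ⱼ} ⊆ 𝔪 ⋅ (⋂ⱼ P(pⱼ)^{mⱼ})`. -/
theorem fat_point_ideal_subset_m_mul_of_charZero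
    {K : Type} [Field K] [CharZero K] (n r : ℕ) (hn : 1 ≤ n)
    (p : Fin r → Fin n → K) (m' m : Fin r → ℕ)
    (h1 : ∀ j, 0 < m' j → m j < m' j)
    (h2 : ∀ j, m' j = 0 → m j = 0)
    (h3 : ∃ j, 0 < m' j) :
    (⨅ j, pointIdeal (p j) ^ m' j) ≤
      irrIdeal K n * ⨅ j, pointIdeal (p j) ^ m j := by
  intro f hf
  rw [← sum_homogeneousComponent f]
  refine sum_mem fun d _ => ?_
  have hg := homogeneousComponent_mem_iInf_pointIdeal_pow p m' hf d
  rw [Ideal.mem_iInf] at hg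
  rcases eq_or_ne d 0 with rfl | hd
  · obtain ⟨j, hj⟩ := h3
    have h0 := constantCoeff_eq_zero_of_mem_pointIdeal (Ideal.pow_le_self hj.ne' (hg j))
    rw [homogeneousComponent_zero, constantCoeff_C] at h0
    rw [homogeneousComponent_zero, h0, C_0]
    exact zero_mem _
  · refine mem_irrIdeal_mul_of_pderiv_mem hd (homogeneousComponent_isHomogeneous d f) fun i => ?_
    rw [Ideal.mem_iInf]
    intro j
    rcases Nat.eq_zero_or_pos (m' j) with hj | hj
    · simp [h2 j hj]
    · exact (pderiv i).apply_mem_pow_of_mem_pow_succ _ _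
        (Ideal.pow_le_pow_right (h1 j hj) (hg j))
end

section
/- Let K be a field and n ≥ 1. Let p₁,…,p_r ∈ Kⁿ be points and let m'₁,…,m'_r and m₁,…,m_r be nonnegative integers such that for every j: if m'_j > 0 then m_j < m'_j, and if m'_j = 0 then m_j = 0. Let F ∈ K[x₁,…,x_n] be homogeneous of degree δ with (δ : K) ≠ 0 in K (this holds e.g. when char K = 0 and δ ≥ 1, or when char K > δ ≥ 1). If F ∈ ⋂_{j=1}^r P(p_j)^{m'_j}, then F ∈ 𝔪 · (⋂_{j=1}^r P(p_j)^{m_j}). -/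
open MvPolynomial

/-- A derivation maps `I ^ (k + 1)` into `I ^ k`. -/
theorem derivation_mem_pow_of_mem_pow_succ {R A : Type*} [CommSemiring R] [CommSemiring A]
    [Algebra R A] (D : Derivation R A A) (I : Ideal A) (k : ℕ) {a : A}
    (ha : a ∈ I ^ (k + 1)) : D a ∈ I ^ k := by
  induction k generalizing a with
  | zero => simp
  | succ k ih =>
    rw [pow_succ] at ha
    refine Submodule.mul_induction_on ha (fun b hb c hc => ?_) (fun b c hb hc => ?_)
    · rw [D.leibniz, smul_eq_mul, smul_eq_mul]
      refine add_mem (Ideal.mul_mem_right _ _ hb) ?_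
      rw [pow_succ, mul_comm c]
      exact Ideal.mul_mem_mul (ih hb) hc
    · rw [map_add]
      exact add_mem hb hc

/-- If `F` is homogeneous of degree `δ` with `(δ : K) ≠ 0` and `F` lies in the
fat point ideal `⋂ⱼ P(pⱼ)^{m'ⱼ}`, where `m_j < m'_j` whenever `m'_j > 0` and
`m_j = 0` when `m'_j = 0`, then `F ∈ 𝔪 ⋅ (⋂ⱼ P(pⱼ)^{mⱼ})`. -/
theorem homogeneous_mem_m_mul_fat_point_ideal
    {K : Type} [Field K] (n r : ℕ) (hn : 1 ≤ n)
    (p : Fin r → Fin n → K) (m' m : Fin r → ℕ)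
    (h1 : ∀ j, 0 < m' j → m j < m' j)
    (h2 : ∀ j, m' j = 0 → m j = 0)
    (F : MvPolynomial (Fin n) K) (δ : ℕ)
    (hF : F.IsHomogeneous δ) (hδ : (δ : K) ≠ 0)
    (hFmem : F ∈ ⨅ j, pointIdeal (p j) ^ m' j) :
    F ∈ irrIdeal K n * ⨅ j, pointIdeal (p j) ^ m j := by
  have hD (i : Fin n) : pderiv i F ∈ ⨅ j, pointIdeal (p j) ^ m j := by
    rw [Ideal.mem_iInf] at hFmem ⊢
    intro j
    rcases Nat.eq_zero_or_pos (m' j) with h | h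
    · simp [h2 j h]
    · exact derivation_mem_pow_of_mem_pow_succ _ _ _ (Ideal.pow_le_pow_right (h1 j h) (hFmem j))
  have euler : F = C (δ : K)⁻¹ * ∑ i, X i * pderiv i F := by
    rw [hF.sum_X_mul_pderiv, nsmul_eq_mul, ← mul_assoc, ← map_natCast C δ, ← C_mul,
      inv_mul_cancel₀ hδ, C_1, one_mul]
  rw [euler]
  exact Ideal.mul_mem_left _ _ (sum_mem fun i _ =>
    Ideal.mul_mem_mul (Ideal.subset_span (Set.mem_range_self i)) (hD i))
end

section
/- Let K be any field and n ≥ 1. For each i ∈ {1,…,n} let Q_i ⊆ K[x₁,…,x_n] be the ideal generated by the variables {x_j : j ≠ i} (this is the ideal P(e_i) of the i-th coordinate vertex). Let m'₁,…,m'_n and m₁,…,m_n be nonnegative integers such that for every i: if m'_i > 0 then m_i < m'_i, and if m'_i = 0 then m_i = 0; assume m'_i > 0 for at least one i. Then ⋂_{i=1}^n Q_i^{m'_i} ⊆ 𝔪 · (⋂_{i=1}^n Q_i^{m_i}). -/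
open MvPolynomial

/-- The ideal `Q_i` of the `i`-th coordinate vertex: generated by the
variables `x_j` with `j ≠ i`. -/
noncomputable def vertexIdeal {K : Type} [Field K] {n : ℕ} (i : Fin n) :
    Ideal (MvPolynomial (Fin n) K) :=
  Ideal.span (X '' {j | j ≠ i})

/-- A polynomial lies in the `k`-th power of the ideal generated by the variables in `s`
iff all its monomials have degree at least `k` in these variables. -/
theorem MvPolynomial.mem_span_X_image_pow_iff {σ R : Type*} [Fintype σ] [DecidableEq σ]
    [CommSemiring R] (s : Finset σ) (k : ℕ) (p : MvPolynomial σ R) :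
    p ∈ Ideal.span (X '' (s : Set σ)) ^ k ↔ ∀ d ∈ p.support, k ≤ ∑ j ∈ s, d j := by
  constructor
  · intro hp
    induction k generalizing p with
    | zero => simp
    | succ k ih =>
      rw [pow_succ] at hp
      induction hp using Submodule.mul_induction_on' with
      | mem_mul_mem a ha b hb =>
        intro d hd
        obtain ⟨u, hu, v, hv, rfl⟩ := Finset.mem_add.mp (support_mul a b hd)
        obtain ⟨j, hj, hvj⟩ := mem_ideal_span_X_image.mp hb v hv
        have h1 := ih a ha u hu
        have h2 : v j ≤ ∑ j ∈ s, v j :=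
          Finset.single_le_sum (f := fun j => v j) (fun _ _ => Nat.zero_le _) hj
        simp only [Finsupp.add_apply, Finset.sum_add_distrib]
        omega
      | add a _ b _ iha ihb =>
        intro d hd
        rcases Finset.mem_union.mp (support_add hd) with h | h
        exacts [iha d h, ihb d h]
  · intro h
    rw [p.as_sum]
    refine Ideal.sum_mem _ fun d hd => ?_
    rw [monomial_eq, Finsupp.prod_fintype _ _ (fun _ => pow_zero _),
      ← Finset.prod_mul_prod_compl s]
    refine Ideal.mul_mem_left _ _ (Ideal.mul_mem_right _ _ (Ideal.pow_le_pow_right (h d hd) ?_))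
    rw [← Finset.prod_pow_eq_pow_sum]
    exact Ideal.prod_mem_prod fun j hj =>
      Ideal.pow_mem_pow (Ideal.subset_span (Set.mem_image_of_mem _ hj)) _

theorem mem_vertexIdeal_pow_iff {K : Type} [Field K] {n : ℕ} (i : Fin n) (k : ℕ)
    (p : MvPolynomial (Fin n) K) :
    p ∈ vertexIdeal i ^ k ↔ ∀ d ∈ p.support, k ≤ ∑ j ∈ Finset.univ.erase i, d j := by
  rw [← mem_span_X_image_pow_iff, vertexIdeal]
  congr! 5
  ext j
  simp

/-- For fat points supported at the coordinate vertices (over any field):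
if `m_i < m'_i` whenever `m'_i > 0`, `m_i = 0` when `m'_i = 0`, and some
`m'_i > 0`, then `⋂ᵢ Q_i^{m'ᵢ} ⊆ 𝔪 ⋅ (⋂ᵢ Q_i^{mᵢ})`. -/
theorem coordinate_vertices_fat_point_subset_m_mul
    {K : Type} [Field K] (n : ℕ) (hn : 1 ≤ n)
    (m' m : Fin n → ℕ)
    (h1 : ∀ i, 0 < m' i → m i < m' i)
    (h2 : ∀ i, m' i = 0 → m i = 0)
    (h3 : ∃ i, 0 < m' i) :
    (⨅ i, vertexIdeal (K := K) i ^ m' i) ≤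
      irrIdeal K n * ⨅ i, vertexIdeal (K := K) i ^ m i := by
  intro p hp
  simp only [Submodule.mem_iInf, mem_vertexIdeal_pow_iff] at hp
  rw [p.as_sum]
  refine Ideal.sum_mem _ fun d hd => ?_
  obtain ⟨i₀, hi₀⟩ := h3
  obtain ⟨j, -, hj⟩ := Finset.sum_pos_iff.mp (hi₀.trans_le (hp i₀ d hd))
  obtain ⟨e, rfl⟩ : ∃ e, d = Finsupp.single j 1 + e :=
    le_iff_exists_add.mp (Finsupp.single_le_iff.mpr hj)
  rw [show monomial (Finsupp.single j 1 + e) (coeff (Finsupp.single j 1 + e) p) =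
    X j * monomial e (coeff (Finsupp.single j 1 + e) p) by simp [X, monomial_mul]]
  refine Ideal.mul_mem_mul (Ideal.subset_span ⟨j, rfl⟩) ?_
  simp only [Submodule.mem_iInf, mem_vertexIdeal_pow_iff]
  intro i d' hd'
  obtain rfl := Finset.mem_singleton.mp (support_monomial_subset hd')
  have hi := hp i _ hd
  have hle : ∑ l ∈ Finset.univ.erase i, Finsupp.single j 1 l ≤ 1 := by
    simp only [Finsupp.single_apply, Finset.sum_ite_eq]
    split_ifs <;> simp
  simp only [Finsupp.add_apply, Finset.sum_add_distrib] at hi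
  have := h1 i
  have := h2 i
  omega
end

section
/- Let K be a field, d ≥ 1, and r ≥ 1. Let p₁,…,p_r ∈ K^{d+1} be points lying in the hyperplane x₀ = 0 (p_j(0) = 0) with each p_j ≠ 0, and let q₁,…,q_r ∈ K^d be their truncations. Let m₁,…,m_r be nonnegative integers and m = max_j m_j. Then in R' = K[x₀,x₁,…,x_d] one has the ideal decomposition ⋂_{j=1}^r P'(p_j)^{m_j} = Σ_{k=0}^{m} (x₀)^k · ( Ideal.map ι ( ⋂_{j=1}^r P(q_j)^{(m_j − k)₊} ) ), where (x₀)^k denotes the k-th power of the principal ideal generated by x₀, P' denotes the point ideal construction in R', P the one in R = K[x₁,…,x_d], and n₊ = max{n,0}. -/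
open MvPolynomial

/-- The ideal of polynomials whose `k`-th coefficient lies in `J k`, for an increasing sequence
of ideals `J`. -/
def Ideal.ofCoeffs {A : Type*} [CommRing A] (J : ℕ → Ideal A) (hJ : Monotone J) :
    Ideal (Polynomial A) where
  carrier := {f | ∀ k, f.coeff k ∈ J k}
  add_mem' hf hg k := by
    rw [Polynomial.coeff_add]
    exact add_mem (hf k) (hg k)
  zero_mem' k := by simp
  smul_mem' c f hf k := by
    rw [smul_eq_mul, Polynomial.coeff_mul]
    refine Submodule.sum_mem _ fun x hx => Ideal.mul_mem_left _ _ (hJ (a := x.2) ?_ (hf x.2))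
    have := Finset.HasAntidiagonal.mem_antidiagonal.1 hx
    omega

theorem Ideal.mem_ofCoeffs {A : Type*} [CommRing A] {J : ℕ → Ideal A} {hJ : Monotone J}
    {f : Polynomial A} : f ∈ Ideal.ofCoeffs J hJ ↔ ∀ k, f.coeff k ∈ J k := Iff.rfl

theorem Ideal.monotone_pow_sub {A : Type*} [CommRing A] (J : Ideal A) (m : ℕ) :
    Monotone fun k => J ^ (m - k) :=
  fun _ _ h => Ideal.pow_le_pow_right (Nat.sub_le_sub_left h m)

theorem Ideal.sum_span_X_pow_mul_map_C {A : Type*} [CommRing A] (J : ℕ → Ideal A)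
    (hJ : Monotone J) (M : ℕ) (hM : J M = ⊤) :
    ∑ k ∈ Finset.range (M + 1), Ideal.span {(Polynomial.X : Polynomial A)} ^ k *
      Ideal.map Polynomial.C (J k) = Ideal.ofCoeffs J hJ := by
  apply le_antisymm
  · rw [Ideal.sum_eq_sup]
    refine Finset.sup_le fun k _ => ?_
    rw [Ideal.span_singleton_pow, Ideal.span_singleton_mul_le_iff]
    intro f hf
    rw [Ideal.mem_map_C_iff] at hf
    intro n
    rw [Polynomial.coeff_X_pow_mul']
    split_ifs with h
    · exact hJ h (hf _)
    · exact zero_mem _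
  · intro f hf
    rw [f.as_sum_range_C_mul_X_pow]
    refine Submodule.sum_mem _ fun k _ => ?_
    have key : ∀ n ≤ M, ∀ a ∈ J n, Polynomial.C a * Polynomial.X ^ n ∈
        ∑ k ∈ Finset.range (M + 1), Ideal.span {(Polynomial.X : Polynomial A)} ^ k *
          Ideal.map Polynomial.C (J k) := by
      intro n hn a ha
      rw [Ideal.sum_eq_sup, mul_comm]
      exact Finset.le_sup (f := fun k => Ideal.span {(Polynomial.X : Polynomial A)} ^ k *
          Ideal.map Polynomial.C (J k)) (Finset.mem_range.2 (Nat.lt_succ_of_le hn))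
        (Ideal.mul_mem_mul (Ideal.pow_mem_pow (Ideal.mem_span_singleton_self _) n)
          (Ideal.mem_map_of_mem _ ha))
    rcases le_total k M with h | h
    · exact key k h _ (hf k)
    · obtain ⟨l, rfl⟩ := Nat.exists_eq_add_of_le h
      rw [pow_add, ← mul_assoc]
      exact Ideal.mul_mem_right _ _ (key M le_rfl _ (hM ▸ Submodule.mem_top))

theorem Ideal.span_X_sup_map_C_pow {A : Type*} [CommRing A] (J : Ideal A) (m : ℕ) :
    (Ideal.span {(Polynomial.X : Polynomial A)} ⊔ Ideal.map Polynomial.C J) ^ m =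
      Ideal.ofCoeffs (fun k => J ^ (m - k)) (J.monotone_pow_sub m) := by
  apply le_antisymm
  · induction m with
    | zero => intro f _ k; simp
    | succ m ih =>
      rw [pow_succ', Ideal.sup_mul]
      refine sup_le ?_ ?_
      · rw [Ideal.span_singleton_mul_le_iff]
        intro f hf k
        cases k with
        | zero => simp
        | succ k => simpa using ih hf k
      · rw [Ideal.mul_le]
        intro f hf g hg k
        rw [Ideal.mem_map_C_iff] at hf
        rw [Polynomial.coeff_mul]
        refine Submodule.sum_mem _ fun x hx => ?_
        have := Finset.HasAntidiagonal.mem_antidiagonal.1 hx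
        have h := Ideal.mul_mem_mul (hf x.1) (ih hg x.2)
        rw [← pow_succ'] at h
        exact Ideal.pow_le_pow_right (by omega) h
  · rw [← Ideal.sum_span_X_pow_mul_map_C _ _ m (by simp), Ideal.sum_eq_sup]
    refine Finset.sup_le fun k hk => ?_
    have hk : k ≤ m := Nat.lt_succ_iff.1 (Finset.mem_range.1 hk)
    rw [Ideal.map_pow]
    calc _ ≤ (Ideal.span {(Polynomial.X : Polynomial A)} ⊔ Ideal.map Polynomial.C J) ^ k *
          (Ideal.span {(Polynomial.X : Polynomial A)} ⊔ Ideal.map Polynomial.C J) ^ (m - k) :=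
          Ideal.mul_mono (Ideal.pow_right_mono le_sup_left k)
            (Ideal.pow_right_mono le_sup_right _)
      _ = _ := by rw [← pow_add, Nat.add_sub_cancel' hk]

theorem finSuccEquiv_rename_succ {K : Type*} [CommRing K] {d : ℕ} (f : MvPolynomial (Fin d) K) :
    finSuccEquiv K d (rename Fin.succ f) = Polynomial.C f := by
  induction f using MvPolynomial.induction_on with
  | C a => simp [finSuccEquiv_apply]
  | add f g hf hg => simp [hf, hg]
  | mul_X f i hf => simp [hf, finSuccEquiv_X_succ]

theorem map_finSuccEquiv_map_rename_succ {K : Type*} [CommRing K] {d : ℕ}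
    (I : Ideal (MvPolynomial (Fin d) K)) :
    Ideal.map (finSuccEquiv K d) (Ideal.map (rename (Fin.succ : Fin d → Fin (d + 1))) I) =
      Ideal.map Polynomial.C I := by
  apply le_antisymm
  · rw [Ideal.map_le_iff_le_comap, Ideal.map_le_iff_le_comap]
    intro f hf
    simp only [Ideal.mem_comap, finSuccEquiv_rename_succ]
    exact Ideal.mem_map_of_mem _ hf
  · rw [Ideal.map_le_iff_le_comap]
    intro f hf
    rw [Ideal.mem_comap, ← finSuccEquiv_rename_succ]
    exact Ideal.mem_map_of_mem _ (Ideal.mem_map_of_mem _ hf)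

theorem map_finSuccEquiv_pointIdeal {K : Type} [Field K] {d : ℕ} (p : Fin (d + 1) → K)
    (hp : p 0 = 0) :
    Ideal.map (finSuccEquiv K d) (pointIdeal p) =
      Ideal.span {Polynomial.X} ⊔ Ideal.map Polynomial.C (pointIdeal fun i => p i.succ) := by
  apply le_antisymm
  · rw [Ideal.map_le_iff_le_comap, pointIdeal, Ideal.span_le]
    rintro l ⟨hl, hlp⟩
    rw [SetLike.mem_coe, Ideal.mem_comap]
    rw [← pow_one (Ideal.span _ ⊔ _), Ideal.span_X_sup_map_C_pow, Ideal.mem_ofCoeffs]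
    intro k
    cases k with
    | succ k => simp
    | zero =>
      simp only [Nat.sub_zero, pow_one]
      refine Ideal.subset_span ⟨hl.finSuccEquiv_coeff_isHomogeneous 0 1 (by simp), ?_⟩
      have hpc : p = Fin.cons 0 (fun i => p i.succ) := by
        rw [← hp]; exact (Fin.cons_self_tail p).symm
      rw [hpc, eval_eq_eval_mv_eval', ← Polynomial.coeff_zero_eq_eval_zero,
        Polynomial.coeff_map] at hlp
      exact hlp
  · refine sup_le ?_ ?_
    · rw [Ideal.span_singleton_le_iff_mem, ← finSuccEquiv_X_zero (R := K)]
      exact Ideal.mem_map_of_mem _ (Ideal.subset_span ⟨isHomogeneous_X _ _, by simp [hp]⟩)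
    · rw [← map_finSuccEquiv_map_rename_succ]
      refine Ideal.map_mono ?_
      rw [pointIdeal, Ideal.map_span, Ideal.span_le]
      rintro _ ⟨l, ⟨hl, hlp⟩, rfl⟩
      refine Ideal.subset_span ⟨hl.rename_isHomogeneous, ?_⟩
      rw [eval_rename]
      exact hlp

/-- Decomposition of a fat point ideal with support in the hyperplane `x₀ = 0`:
`⋂ⱼ P'(pⱼ)^{mⱼ} = Σ_{k=0}^{m} (x₀)^k ⋅ ι(⋂ⱼ P(qⱼ)^{(mⱼ−k)₊})`, where the `qⱼ`
are the truncations of the `pⱼ` and `m = maxⱼ mⱼ`. -/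
theorem fat_point_ideal_eq_sum_powers_x0
    {K : Type} [Field K] (d r : ℕ) (hd : 1 ≤ d) (hr : 1 ≤ r)
    (p : Fin r → Fin (d + 1) → K)
    (hp0 : ∀ j, p j 0 = 0) (hpne : ∀ j, p j ≠ 0)
    (m : Fin r → ℕ) :
    (⨅ j, pointIdeal (p j) ^ m j) =
      ∑ k ∈ Finset.range (Finset.univ.sup m + 1),
        (Ideal.span {(X 0 : MvPolynomial (Fin (d + 1)) K)}) ^ k *
          Ideal.map (rename (Fin.succ : Fin d → Fin (d + 1)))
            (⨅ j, pointIdeal (fun i => p j i.succ) ^ (m j - k)) := by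
  have hcomap (I : Ideal (MvPolynomial (Fin (d + 1)) K)) :
      Ideal.comap (finSuccEquiv K d) (Ideal.map (finSuccEquiv K d) I) = I :=
    Ideal.comap_map_of_bijective _ (finSuccEquiv K d).bijective
  have hJ : Monotone fun k => ⨅ j, pointIdeal (fun i => p j i.succ) ^ (m j - k) :=
    fun _ _ h => iInf_mono fun j => Ideal.monotone_pow_sub _ (m j) h
  have hM : (⨅ j, pointIdeal (fun i => p j i.succ) ^ (m j - Finset.univ.sup m)) = ⊤ := by
    refine iInf_eq_top.2 fun j => ?_
    rw [Nat.sub_eq_zero_of_le (Finset.le_sup (Finset.mem_univ j)), pow_zero, Ideal.one_eq_top]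
  rw [← hcomap (∑ k ∈ _, _), ← Ideal.mapHom_apply, map_sum]
  simp only [Ideal.mapHom_apply, Ideal.map_mul, Ideal.map_pow, Ideal.map_span,
    Set.image_singleton, finSuccEquiv_X_zero, map_finSuccEquiv_map_rename_succ]
  rw [Ideal.sum_span_X_pow_mul_map_C _ hJ _ hM]
  ext f
  rw [Ideal.mem_comap, Ideal.mem_ofCoeffs]
  simp only [Ideal.mem_iInf]
  rw [forall_comm]
  refine forall_congr' fun j => ?_
  rw [← hcomap (pointIdeal (p j) ^ m j), Ideal.map_pow, map_finSuccEquiv_pointIdeal _ (hp0 j),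
    Ideal.span_X_sup_map_C_pow, Ideal.mem_comap, Ideal.mem_ofCoeffs]
end

section
/- Let K be a field, n ≥ 1, and p ∈ Kⁿ. Let ℓ ∈ K[x₁,…,x_n] be a nonzero homogeneous polynomial of degree 1 with ℓ(p) = 0 (so ℓ ∈ P(p)). Then for every m ≥ 1 and every polynomial f: if ℓ·f ∈ P(p)^m, then f ∈ P(p)^{m−1}. (Equivalently, the colon ideal P(p)^m : (ℓ) equals P(p)^{m−1}, reflecting that dividing out a linear form vanishing at p lowers the order of vanishing at p by exactly one.) -/
open MvPolynomial

/-- A homogeneous polynomial of degree one is the linear combination of the variables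
given by its coefficients. -/
theorem MvPolynomial.IsHomogeneous.eq_sum_C_mul_X {R σ : Type*} [CommSemiring R] [Fintype σ]
    {ℓ : MvPolynomial σ R} (hℓ : ℓ.IsHomogeneous 1) :
    ∃ a : σ → R, ℓ = ∑ j, C (a j) * X j := by
  have h : ℓ ∈ homogeneousSubmodule σ R 1 := hℓ
  rw [homogeneousSubmodule_one_eq_span_X, Submodule.mem_span_range_iff_exists_fun] at h
  obtain ⟨a, rfl⟩ := h
  exact ⟨a, by simp only [smul_eq_C_mul]⟩

section Rees

variable {K : Type*} [Field K] {n : ℕ}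

/-- The coordinates of the projection of the generic point onto the line through `p`, read off
from the `i`-th coordinate (all zero if `p i = 0`). -/
noncomputable def linePart (p : Fin n → K) (i j : Fin n) : MvPolynomial (Fin n) K :=
  C (p j * (p i)⁻¹) * X i

/-- The substitution `x ↦ s + T (x - s)`, where `s` is the `linePart` of `x`. -/
noncomputable def reesHom (p : Fin n → K) (i : Fin n) :
    MvPolynomial (Fin n) K →ₐ[K] Polynomial (MvPolynomial (Fin n) K) :=
  aeval fun j =>
    Polynomial.C (linePart p i j) + Polynomial.X * Polynomial.C (X j - linePart p i j)

theorem reesHom_linear {p : Fin n → K} (i : Fin n) {ℓ : MvPolynomial (Fin n) K}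
    (hℓ : ℓ.IsHomogeneous 1) (hℓp : eval p ℓ = 0) :
    reesHom p i ℓ = Polynomial.X * Polynomial.C ℓ := by
  obtain ⟨a, rfl⟩ := hℓ.eq_sum_C_mul_X
  have hs : ∑ j, C (a j) * linePart p i j = 0 := by
    have h : ∑ j, a j * p j = 0 := by simpa using hℓp
    calc ∑ j, C (a j) * linePart p i j = C ((∑ j, a j * p j) * (p i)⁻¹) * X i := by
          simp only [linePart, Finset.sum_mul, map_sum, map_mul]
          exact Finset.sum_congr rfl fun j _ => by ring
      _ = 0 := by simp [h]
  have hs' := congrArg (Polynomial.C (R := MvPolynomial (Fin n) K)) hs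
  have hC (b : K) : reesHom p i (C b) = Polynomial.C (C b) := (reesHom p i).commutes b
  have hX (j : Fin n) : reesHom p i (X j) = Polynomial.C (linePart p i j) +
      Polynomial.X * Polynomial.C (X j - linePart p i j) := by simp [reesHom]
  simp only [map_sum, map_mul, map_zero] at hs'
  simp only [map_sum, map_mul, hC, hX]
  calc _ = (1 - Polynomial.X) * ∑ j, Polynomial.C (C (a j)) * Polynomial.C (linePart p i j) +
        Polynomial.X * ∑ j, Polynomial.C (C (a j)) * Polynomial.C (X j) := by
        simp only [Finset.mul_sum, ← Finset.sum_add_distrib]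
        refine Finset.sum_congr rfl fun j _ => ?_
        rw [map_sub]
        ring
    _ = _ := by rw [hs', mul_zero, zero_add]

theorem eval_one_reesHom (p : Fin n → K) (i : Fin n) (f : MvPolynomial (Fin n) K) :
    (reesHom p i f).eval 1 = f := by
  have h : (Polynomial.evalRingHom 1).comp (reesHom p i).toRingHom =
      RingHom.id (MvPolynomial (Fin n) K) := by
    refine MvPolynomial.ringHom_ext (fun b => ?_) fun j => ?_
    · have hC : reesHom p i (C b) = Polynomial.C (C b) := (reesHom p i).commutes b
      simp [hC]
    · simp [reesHom]
  exact RingHom.congr_fun h f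

end Rees

theorem reesHom_mem_reesAlgebra {K : Type} [Field K] {n : ℕ} {p : Fin n → K} {i : Fin n}
    (hi : ∀ j, p j * (p i)⁻¹ * p i = p j) (f : MvPolynomial (Fin n) K) :
    reesHom p i f ∈ reesAlgebra (pointIdeal p) := by
  induction f using MvPolynomial.induction_on with
  | C a =>
    have hC : reesHom p i (C a) = Polynomial.C (C a) := (reesHom p i).commutes a
    rw [hC]
    exact (reesAlgebra (pointIdeal p)).algebraMap_mem (C a)
  | add f g hf hg =>
    rw [map_add]
    exact add_mem hf hg
  | mul_X f j hf =>
    rw [map_mul]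
    refine mul_mem hf ?_
    have hX : reesHom p i (X j) = Polynomial.C (linePart p i j) +
        Polynomial.X * Polynomial.C (X j - linePart p i j) := by simp [reesHom]
    rw [hX, mul_comm, Polynomial.C_mul_X_eq_monomial]
    refine add_mem ((reesAlgebra (pointIdeal p)).algebraMap_mem _)
      (reesAlgebra.monomial_mem.2 ?_)
    rw [pow_one]
    refine Ideal.subset_span ⟨?_, ?_⟩
    · exact (isHomogeneous_X K j).sub (isHomogeneous_C_mul_X _ i)
    · simp [linePart, hi]

theorem X_pow_dvd_reesHom {K : Type} [Field K] {n : ℕ} {p : Fin n → K} (i : Fin n) {m : ℕ}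
    {f : MvPolynomial (Fin n) K} (hf : f ∈ pointIdeal p ^ m) :
    Polynomial.X ^ m ∣ reesHom p i f := by
  have h : pointIdeal p ≤ (Ideal.span {Polynomial.X}).comap (reesHom p i) := by
    refine Ideal.span_le.2 fun ℓ hℓ => ?_
    rw [SetLike.mem_coe, Ideal.mem_comap, Ideal.mem_span_singleton,
      reesHom_linear i hℓ.1 hℓ.2]
    exact dvd_mul_right _ _
  have h' := Ideal.le_comap_pow (reesHom p i) m (Ideal.pow_right_mono h m hf)
  rwa [Ideal.mem_comap, Ideal.span_singleton_pow, Ideal.mem_span_singleton] at h'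

theorem mem_pow_of_X_pow_dvd_reesHom {K : Type} [Field K] {n : ℕ} {p : Fin n → K} {i : Fin n}
    (hi : ∀ j, p j * (p i)⁻¹ * p i = p j) {m : ℕ} {f : MvPolynomial (Fin n) K}
    (hf : Polynomial.X ^ m ∣ reesHom p i f) : f ∈ pointIdeal p ^ m := by
  rw [← eval_one_reesHom p i f, Polynomial.eval_eq_sum_range]
  refine Ideal.sum_mem _ fun k _ => ?_
  rw [one_pow, mul_one]
  obtain hk | hk := lt_or_ge k m
  · rw [Polynomial.X_pow_dvd_iff.1 hf k hk]
    exact zero_mem _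
  · exact Ideal.pow_le_pow_right hk
      ((mem_reesAlgebra_iff _ _).1 (reesHom_mem_reesAlgebra hi f) k)

/-- Dividing by a linear form vanishing at `p` lowers the order of vanishing at
`p` by exactly one: if `ℓ ≠ 0` is linear with `ℓ(p) = 0` and `ℓ⬝f ∈ P(p)^m`
(`m ≥ 1`), then `f ∈ P(p)^{m−1}`. -/
theorem mem_pow_pred_of_linear_mul_mem_pow
    {K : Type} [Field K] (n : ℕ) (hn : 1 ≤ n) (p : Fin n → K)
    (ℓ : MvPolynomial (Fin n) K) (hℓ0 : ℓ ≠ 0)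
    (hℓ : ℓ.IsHomogeneous 1) (hℓp : eval p ℓ = 0) :
    ∀ m : ℕ, 1 ≤ m → ∀ f : MvPolynomial (Fin n) K,
      ℓ * f ∈ pointIdeal p ^ m → f ∈ pointIdeal p ^ (m - 1) := by
  intro m hm f hf
  obtain ⟨i, hi⟩ : ∃ i, ∀ j, p j * (p i)⁻¹ * p i = p j := by
    by_cases hp : ∃ i, p i ≠ 0
    · obtain ⟨i, hi⟩ := hp
      exact ⟨i, fun j => inv_mul_cancel_right₀ hi (p j)⟩
    · push Not at hp
      exact ⟨⟨0, hn⟩, fun j => by simp [hp]⟩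
  refine mem_pow_of_X_pow_dvd_reesHom hi (Polynomial.X_pow_dvd_iff.2 fun k hk => ?_)
  have h := Polynomial.X_pow_dvd_iff.1 (X_pow_dvd_reesHom i hf) (k + 1) (by omega)
  rw [map_mul, reesHom_linear i hℓ hℓp, mul_assoc, Polynomial.coeff_X_mul,
    Polynomial.coeff_C_mul] at h
  exact (mul_eq_zero.1 h).resolve_left hℓ0
end

section
/- Let K be a field, d ≥ 1, e ≥ 1, and r ≥ 1. Let q₁,…,q_r ∈ K^d be nonzero points, and let p₁,…,p_r ∈ K^{d+e} be the same points regarded in the coordinate linear subspace given by vanishing of the last e coordinates (p_j agrees with q_j on the first d coordinates and is 0 on the rest). Let m₁,…,m_r be nonnegative integers, m = max_j m_j, and for 0 ≤ i ≤ m set a_i(j) = (m_j − (m − i))₊. Let J_i = ⋂_{j=1}^r P(q_j)^{a_i(j)} in R = K[x₁,…,x_d] and J'_i = ⋂_{j=1}^r P'(p_j)^{a_i(j)} in R' = K[x₁,…,x_{d+e}], and let 𝔪_R and 𝔪_{R'} be the ideals generated by all the variables of R and R' respectively. If J_{i+1} ⊆ 𝔪_R · J_i for every 0 ≤ i < m,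 then J'_{i+1} ⊆ 𝔪_{R'} · J'_i for every 0 ≤ i < m. -/
open MvPolynomial

namespace MvPolynomial

section ExtendedIdeal

variable {σ A : Type*} [CommRing A]

/-- The ideal of `A[y]` generated by an ideal `I` of `A` and the variables. -/
noncomputable def extendByVars (σ : Type*) (I : Ideal A) : Ideal (MvPolynomial σ A) :=
  I.map C ⊔ Ideal.span (Set.range X)

theorem C_mem_extendByVars {I : Ideal A} {f : A} (hf : f ∈ I) : C f ∈ extendByVars σ I :=
  Ideal.mem_sup_left (Ideal.mem_map_of_mem C hf)

theorem X_mem_extendByVars (I : Ideal A) (k : σ) : X k ∈ extendByVars σ I :=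
  Ideal.mem_sup_right (Ideal.subset_span ⟨k, rfl⟩)

theorem extendByVars_le_comap_constantCoeff (I : Ideal A) :
    extendByVars σ I ≤ I.comap constantCoeff := by
  refine sup_le (Ideal.map_le_iff_le_comap.mpr fun f hf => ?_) (Ideal.span_le.mpr ?_)
  · simpa using hf
  · rintro _ ⟨k, rfl⟩
    simp

theorem coeff_mem_pow_of_mem_extendByVars_pow (I : Ideal A) (a : ℕ) {F : MvPolynomial σ A}
    (hF : F ∈ extendByVars σ I ^ a) (β : σ →₀ ℕ) : coeff β F ∈ I ^ (a - β.degree) := by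
  classical
  induction a generalizing F β with
  | zero => simp
  | succ a ih =>
    rw [pow_succ] at hF
    induction hF using Submodule.mul_induction_on' with
    | mem_mul_mem F hF G hG =>
      rw [coeff_mul]
      refine Ideal.sum_mem _ fun x hx => ?_
      obtain rfl := Finset.HasAntidiagonal.mem_antidiagonal.mp hx
      rw [map_add]
      by_cases h0 : x.2 = 0
      · have hG0 : coeff x.2 G ∈ I := by
          rw [h0]
          exact extendByVars_le_comap_constantCoeff I hG
        have := Ideal.mul_mem_mul (ih hF x.1) hG0
        rw [← pow_succ] at this
        refine Ideal.pow_le_pow_right ?_ this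
        omega
      · have : x.2.degree ≠ 0 := by rwa [Ne, Finsupp.degree_eq_zero_iff]
        refine Ideal.pow_le_pow_right ?_ (Ideal.mul_mem_right _ _ (ih hF x.1))
        omega
    | add F _ G _ hF hG =>
      rw [coeff_add]
      exact add_mem hF hG

theorem monomial_one_mem_extendByVars_pow (I : Ideal A) (β : σ →₀ ℕ) :
    monomial β (1 : A) ∈ extendByVars σ I ^ β.degree := by
  rw [monomial_eq, C_1, one_mul, Finsupp.degree_apply, ← Finset.prod_pow_eq_pow_sum]
  exact Ideal.prod_mem_prod fun k _ => Ideal.pow_mem_pow (X_mem_extendByVars I k) _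

theorem monomial_mem_extendByVars_pow (I : Ideal A) (a : ℕ) (β : σ →₀ ℕ) {f : A}
    (hf : f ∈ I ^ (a - β.degree)) : monomial β f ∈ extendByVars σ I ^ a := by
  have hC : C f ∈ extendByVars σ I ^ (a - β.degree) := by
    refine Ideal.pow_right_mono (le_sup_left : I.map C ≤ _) _ ?_
    rw [← Ideal.map_pow]
    exact Ideal.mem_map_of_mem C hf
  have h := Ideal.mul_mem_mul hC (monomial_one_mem_extendByVars_pow I β)
  rw [← pow_add, C_mul_monomial, mul_one] at h
  exact Ideal.pow_le_pow_right (by omega) h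

theorem mem_extendByVars_of_constantCoeff_mem (I : Ideal A) {F : MvPolynomial σ A}
    (hF : constantCoeff F ∈ I) : F ∈ extendByVars σ I := by
  rw [F.as_sum]
  refine Ideal.sum_mem _ fun β _ => ?_
  rw [← pow_one (extendByVars σ I)]
  apply monomial_mem_extendByVars_pow
  by_cases h0 : β = 0
  · subst h0
    simpa [constantCoeff_eq] using hF
  · have : β.degree ≠ 0 := by rwa [Ne, Finsupp.degree_eq_zero_iff]
    rw [Nat.sub_eq_zero_of_le (by omega)]
    simp

/-- If fat intersections `⨅ j, I j ^ (m j - (M - i))` in `A` satisfy the criterion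
`J (i + 1) ≤ N * J i`, so do the intersections of powers of the extended ideals. -/
theorem iInf_extendByVars_pow_succ_le {ι : Type*} (I : ι → Ideal A) (m : ι → ℕ) (M : ℕ)
    (hM : ∀ j, m j ≤ M) (N : Ideal A)
    (hyp : ∀ i < M, (⨅ j, I j ^ (m j - (M - (i + 1)))) ≤ N * ⨅ j, I j ^ (m j - (M - i)))
    (i : ℕ) (hi : i < M) :
    (⨅ j, extendByVars σ (I j) ^ (m j - (M - (i + 1)))) ≤
      extendByVars σ N * ⨅ j, extendByVars σ (I j) ^ (m j - (M - i)) := by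
  intro F hF
  rw [F.as_sum]
  refine Ideal.sum_mem _ fun β _ => ?_
  by_cases hβ : β.degree ≤ i
  · have hf : coeff β F ∈ ⨅ j, I j ^ (m j - (M - (i - β.degree + 1))) := by
      refine Ideal.mem_iInf.mpr fun j => ?_
      have := coeff_mem_pow_of_mem_extendByVars_pow _ _ (Ideal.mem_iInf.mp hF j) β
      refine Ideal.pow_le_pow_right ?_ this
      omega
    replace hf := hyp _ (by omega) hf
    generalize coeff β F = f at hf
    induction hf using Submodule.mul_induction_on' with
    | mem_mul_mem x hx g hg =>
      rw [← C_mul_monomial]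
      refine Ideal.mul_mem_mul (C_mem_extendByVars hx) (Ideal.mem_iInf.mpr fun j => ?_)
      apply monomial_mem_extendByVars_pow
      refine Ideal.pow_le_pow_right ?_ (Ideal.mem_iInf.mp hg j)
      omega
    | add f _ g _ hf hg =>
      rw [map_add]
      exact add_mem hf hg
  · obtain ⟨k, hk⟩ : ∃ k, β k ≠ 0 := by
      by_contra! h
      have : β = 0 := Finsupp.ext h
      simp [this] at hβ
    have hle : Finsupp.single k 1 ≤ β := by
      simpa [Finsupp.single_le_iff] using Nat.one_le_iff_ne_zero.mpr hk
    obtain ⟨γ, rfl⟩ := exists_add_of_le hle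
    rw [map_add, Finsupp.degree_single] at hβ
    have hmul : monomial (Finsupp.single k 1 + γ) (coeff (Finsupp.single k 1 + γ) F) =
        X k * monomial γ (coeff (Finsupp.single k 1 + γ) F) := by
      rw [X, monomial_mul, one_mul]
    rw [hmul]
    refine Ideal.mul_mem_mul (X_mem_extendByVars N k) (Ideal.mem_iInf.mpr fun j => ?_)
    apply monomial_mem_extendByVars_pow
    have := hM j
    rw [Nat.sub_eq_zero_of_le (by omega)]
    simp

end ExtendedIdeal

/-- Polynomials in `d + e` variables as polynomials in the last `e` variables over the
polynomial ring in the first `d`. -/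
noncomputable def finAddAlgEquiv (K : Type*) [CommRing K] (d e : ℕ) :
    MvPolynomial (Fin (d + e)) K ≃ₐ[K] MvPolynomial (Fin e) (MvPolynomial (Fin d) K) :=
  (renameEquiv K (finSumFinEquiv.symm.trans (Equiv.sumComm (Fin d) (Fin e)))).trans
    (sumAlgEquiv K (Fin e) (Fin d))

section FinAdd

variable {K : Type*} [CommRing K] {d e : ℕ}

@[simp]
theorem finAddAlgEquiv_X_castAdd (k : Fin d) :
    finAddAlgEquiv K d e (X (Fin.castAdd e k)) = C (X k) := by
  simp [finAddAlgEquiv]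

@[simp]
theorem finAddAlgEquiv_X_natAdd (k : Fin e) :
    finAddAlgEquiv K d e (X (Fin.natAdd d k)) = X k := by
  simp [finAddAlgEquiv]

theorem finAddAlgEquiv_rename_castAdd (f : MvPolynomial (Fin d) K) :
    finAddAlgEquiv K d e (rename (Fin.castAdd e) f) = C f := by
  have : ((finAddAlgEquiv K d e).toAlgHom.comp (rename (Fin.castAdd e))) =
      (IsScalarTower.toAlgHom K (MvPolynomial (Fin d) K)
        (MvPolynomial (Fin e) (MvPolynomial (Fin d) K))) := by
    ext k : 1
    simp [MvPolynomial.algebraMap_eq]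
  exact DFunLike.congr_fun this f

theorem constantCoeff_finAddAlgEquiv (F : MvPolynomial (Fin (d + e)) K) :
    constantCoeff (finAddAlgEquiv K d e F) =
      aeval (Fin.append (X : Fin d → MvPolynomial (Fin d) K) 0) F := by
  induction F using MvPolynomial.induction_on with
  | C a =>
    rw [← MvPolynomial.algebraMap_eq, AlgEquiv.commutes, AlgHom.commutes,
      IsScalarTower.algebraMap_apply K (MvPolynomial (Fin d) K)]
    simp [MvPolynomial.algebraMap_eq]
  | add p q hp hq => simp [hp, hq]
  | mul_X p k hp =>
    rw [map_mul, map_mul, map_mul, hp, aeval_X]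
    congr 1
    induction k using Fin.addCases <;> simp

end FinAdd

end MvPolynomial

theorem map_pointIdeal_append_zero {K : Type} [Field K] {d e : ℕ} (q : Fin d → K) :
    (pointIdeal (Fin.append q (0 : Fin e → K))).map (finAddAlgEquiv K d e) =
      extendByVars (Fin e) (pointIdeal q) := by
  apply le_antisymm
  · rw [Ideal.map_le_iff_le_comap, pointIdeal, Ideal.span_le]
    rintro ℓ ⟨hℓ, hp⟩
    apply mem_extendByVars_of_constantCoeff_mem
    rw [constantCoeff_finAddAlgEquiv]
    refine Ideal.subset_span ⟨?_, ?_⟩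
    · have := hℓ.aeval (Fin.append (X : Fin d → MvPolynomial (Fin d) K) (0 : Fin e → _))
        (n := 1) fun k => by
          induction k using Fin.addCases with
          | left k => simpa using isHomogeneous_X K k
          | right k => simpa using isHomogeneous_zero (Fin d) K 1
      simpa using this
    · rw [← hp, ← aeval_eq_eval, ← aeval_eq_eval]
      change (aeval q) (aeval _ ℓ) = aeval _ ℓ
      rw [← AlgHom.comp_apply, comp_aeval]
      congr 2
      funext k
      induction k using Fin.addCases <;> simp
  · refine sup_le ?_ (Ideal.span_le.mpr ?_)
    · rw [Ideal.map_le_iff_le_comap, pointIdeal, Ideal.span_le]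
      rintro ℓ ⟨hℓ, hq⟩
      rw [SetLike.mem_coe, Ideal.mem_comap, ← finAddAlgEquiv_rename_castAdd]
      refine Ideal.mem_map_of_mem _ (Ideal.subset_span ⟨hℓ.rename_isHomogeneous, ?_⟩)
      rw [eval_rename, ← hq]
      congr 2
      funext k
      simp
    · rintro _ ⟨k, rfl⟩
      rw [← finAddAlgEquiv_X_natAdd (K := K) (d := d)]
      exact Ideal.mem_map_of_mem _ (Ideal.subset_span ⟨isHomogeneous_X K _, by simp⟩)

theorem extendByVars_irrIdeal_le (K : Type) [Field K] (d e : ℕ) :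
    extendByVars (Fin e) (irrIdeal K d) ≤ (irrIdeal K (d + e)).map (finAddAlgEquiv K d e) := by
  refine sup_le ?_ (Ideal.span_le.mpr ?_)
  · rw [Ideal.map_le_iff_le_comap, irrIdeal, Ideal.span_le]
    rintro _ ⟨k, rfl⟩
    rw [SetLike.mem_coe, Ideal.mem_comap, ← finAddAlgEquiv_X_castAdd]
    exact Ideal.mem_map_of_mem _ (Ideal.subset_span ⟨_, rfl⟩)
  · rintro _ ⟨k, rfl⟩
    rw [← finAddAlgEquiv_X_natAdd (K := K) (d := d)]
    exact Ideal.mem_map_of_mem _ (Ideal.subset_span ⟨_, rfl⟩)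

theorem map_iInf_pointIdeal_append_zero_pow {K : Type} [Field K] {d e : ℕ} {ι : Type*}
    (q : ι → Fin d → K) (a : ι → ℕ) :
    (⨅ j, pointIdeal (Fin.append (q j) (0 : Fin e → K)) ^ a j).map (finAddAlgEquiv K d e) =
      ⨅ j, extendByVars (Fin e) (pointIdeal (q j)) ^ a j := by
  have hmap (I : Ideal (MvPolynomial (Fin (d + e)) K)) :
      I.map (finAddAlgEquiv K d e) = I.comap (finAddAlgEquiv K d e).symm :=
    (Ideal.comap_symm (I := I) (finAddAlgEquiv K d e).toRingEquiv).symm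
  rw [hmap, Ideal.comap_iInf]
  simp_rw [← hmap, Ideal.map_pow, map_pointIdeal_append_zero]

/-- Bootstrapping: if the minimality criterion `J_{i+1} ⊆ 𝔪⋅J_i` holds for the
fat point subschemes `Z_i` supported at `q₁,…,q_r` in `K^d`, then it also holds
for the corresponding fat point subschemes supported at the same points viewed
inside the coordinate subspace of `K^{d+e}` cut out by the last `e`
coordinates. -/
theorem bootstrap_criterion_linear_subspace
    {K : Type} [Field K] (d e r : ℕ) (hd : 1 ≤ d) (he : 1 ≤ e) (hr : 1 ≤ r)
    (q : Fin r → Fin d → K) (hq : ∀ j, q j ≠ 0)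
    (m : Fin r → ℕ)
    (hyp : ∀ i : ℕ, i < Finset.univ.sup m →
      (⨅ j, pointIdeal (q j) ^ (m j - (Finset.univ.sup m - (i + 1)))) ≤
        irrIdeal K d *
          ⨅ j, pointIdeal (q j) ^ (m j - (Finset.univ.sup m - i))) :
    ∀ i : ℕ, i < Finset.univ.sup m →
      (⨅ j, pointIdeal (Fin.append (q j) (0 : Fin e → K)) ^
          (m j - (Finset.univ.sup m - (i + 1)))) ≤
        irrIdeal K (d + e) *
          ⨅ j, pointIdeal (Fin.append (q j) (0 : Fin e → K)) ^
            (m j - (Finset.univ.sup m - i)) := by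
  intro i hi
  have key := iInf_extendByVars_pow_succ_le (σ := Fin e) (fun j => pointIdeal (q j)) m
    (Finset.univ.sup m) (fun j => Finset.le_sup (Finset.mem_univ j)) (irrIdeal K d) hyp i hi
  rw [← map_iInf_pointIdeal_append_zero_pow, ← map_iInf_pointIdeal_append_zero_pow] at key
  have key := key.trans (Ideal.mul_mono_left (extendByVars_irrIdeal_le K d e))
  rw [← Ideal.map_mul, Ideal.map_le_iff_le_comap] at key
  refine key.trans_eq (Ideal.comap_map_of_bijective _ (finAddAlgEquiv K d e).bijective)
end
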